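/- arXiv:2206.13251 — 2 statements merged into one kernel-verified Lean document; each statement's English description precedes it below -/
import Mathlib

section
/- There exist 16 points in the Euclidean plane, in convex position, with all pairwise distances at most 1, such that the perimeter of the convex polygon they span is strictly greater than 3.1365477164866. -/
open Real

/-- Cyclic successor on `Fin n`. -/
def vnext {n : ℕ} (i : Fin n) : Fin n := ⟨(i.1 + 1) % n, Nat.mod_lt _ i.pos⟩

/-- `p` lists the vertices of a convex polygon in the Euclidean plane in
counterclockwise order: every vertex `p j` lies strictly to the left of each
directed edge from `p i` to `p (vnext i)`.  In particular the points are in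
convex position (each is an extreme point of their convex hull). -/
def IsConvexPolygon {n : ℕ} (p : Fin n → EuclideanSpace ℝ (Fin 2)) : Prop :=
  ∀ i j : Fin n, j ≠ i → j ≠ vnext i →
    0 < (p (vnext i) 0 - p i 0) * (p j 1 - p i 1) -
        (p (vnext i) 1 - p i 1) * (p j 0 - p i 0)

/-- The perimeter of the polygon with vertices `p 0, p 1, …, p (n-1)` (in this
cyclic order): the sum of the lengths of its `n` sides. -/
noncomputable def perimeter {n : ℕ} (p : Fin n → EuclideanSpace ℝ (Fin 2)) : ℝ :=
  ∑ i : Fin n, dist (p i) (p (vnext i))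

/-- Abscissas, in units of `10⁻²²`, of the vertices of a small hexadecagon of nearly maximal
perimeter. -/
def hexadecagonX : Fin 16 → ℤ := ![
  -4923747098929025277290, -4357267955873171471133, -2839356921368776096419, -954425107027808644090,
  1005112857841103717697, 2892752799582690197070, 4147661175726153977659, 5076252901070974712709,
  4881372739400320662038, 3952676961146422413564, 2701989170944700003782, 971004650088512004071,
  -965943897457743468852, -2676287770191955773198, -4176609572225414675133, -4735184932726982282474]

/-- Ordinates, in units of `10⁻²²`, of the vertices of a small hexadecagon of nearly maximal
perimeter. -/
def hexadecagonY : Fin 16 → ℤ := ![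
  -1012386780966588903568, -2875001570807185994369, -4116413516165617407034, -4683697565270637870123,
  -4870753977406442088521, -4292464531060668792566, -2761037782679790611265, -1012386780966588903568,
  952206040968862623123, 2687804868041842905561, 4207857231785951245758, 5129187853932573547569,
  4933068505043491594762, 4013303773690197924107, 2780308309633685488936, 920405922226915241198]

/-- Lower bounds, in units of `10⁻²²`, for the side lengths of the hexadecagon. -/
def hexadecagonSide : Fin 16 → ℤ := ![
  1946851939632345577573, 1960907322325256876449, 1968445868466724858098, 1968445868466724858098,
  1974234847583508999369, 1979914876496324209873, 1979914876496324209872, 1974234847583508999369,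
  1968445868466724858099, 1968445868466724858098, 1960907322325256876449, 1946851939632345577573,
  1941968929731075767641, 1941968929731075767641, 1941968929731075767641, 1941968929731075767640]

lemma hexadecagon_counterclockwise (i j : Fin 16) (hi : j ≠ i) (hn : j ≠ vnext i) :
    0 < (hexadecagonX (vnext i) - hexadecagonX i) * (hexadecagonY j - hexadecagonY i) -
      (hexadecagonY (vnext i) - hexadecagonY i) * (hexadecagonX j - hexadecagonX i) := by
  revert i j
  decide +kernel

lemma hexadecagon_sq_dist_le (i j : Fin 16) :
    (hexadecagonX i - hexadecagonX j) ^ 2 + (hexadecagonY i - hexadecagonY j) ^ 2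
      ≤ (10 ^ 22) ^ 2 := by
  revert i j
  decide +kernel

lemma hexadecagonSide_sq_le (i : Fin 16) :
    hexadecagonSide i ^ 2 ≤ (hexadecagonX i - hexadecagonX (vnext i)) ^ 2 +
      (hexadecagonY i - hexadecagonY (vnext i)) ^ 2 := by
  revert i
  decide +kernel

lemma lt_sum_hexadecagonSide : 31365477164866 * 10 ^ 9 < ∑ i, hexadecagonSide i := by
  decide +kernel

/-- The point of the plane with coordinates `x / 10²²` and `y / 10²²`. -/
noncomputable def scaledPoint (x y : ℤ) : EuclideanSpace ℝ (Fin 2) :=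
  !₂[(x : ℝ) / 10 ^ 22, (y : ℝ) / 10 ^ 22]

lemma dist_scaledPoint (x y x' y' : ℤ) :
    dist (scaledPoint x y) (scaledPoint x' y') =
      √(((x - x') ^ 2 + (y - y') ^ 2 : ℤ) : ℝ) / 10 ^ 22 := by
  rw [EuclideanSpace.dist_eq, Fin.sum_univ_two, Real.dist_eq, Real.dist_eq, sq_abs, sq_abs,
    ← Real.sqrt_sq (by positivity : (0 : ℝ) ≤ 10 ^ 22),
    ← Real.sqrt_div' _ (by positivity : (0 : ℝ) ≤ (10 ^ 22) ^ 2)]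
  congr 1
  simp only [scaledPoint, PiLp.toLp_apply, Matrix.cons_val_zero, Matrix.cons_val_one]
  push_cast
  field_simp

/-- There is a convex `16`-gon of diameter at most `1` whose perimeter exceeds
`3.1365477164866`. -/
theorem exists_small_16gon_long_perimeter :
    ∃ p : Fin 16 → EuclideanSpace ℝ (Fin 2), IsConvexPolygon p ∧
      (∀ i j : Fin 16, dist (p i) (p j) ≤ 1) ∧
      3.1365477164866 < perimeter p := by
  refine ⟨fun i => scaledPoint (hexadecagonX i) (hexadecagonY i), ?_, ?_, ?_⟩
  · intro i j hi hn
    have h : (0 : ℝ) < _ := Int.cast_pos.mpr (hexadecagon_counterclockwise i j hi hn)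
    push_cast at h
    simp only [scaledPoint, PiLp.toLp_apply, Matrix.cons_val_zero, Matrix.cons_val_one]
    refine (div_pos h (by positivity : (0 : ℝ) < (10 ^ 22) ^ 2)).trans_eq ?_
    field_simp
  · intro i j
    rw [dist_scaledPoint]
    refine div_le_one_of_le₀ (Real.sqrt_le_iff.mpr ⟨by positivity, ?_⟩) (by positivity)
    exact_mod_cast hexadecagon_sq_dist_le i j
  · have hside (i : Fin 16) : (hexadecagonSide i : ℝ) / 10 ^ 22 ≤
        dist (scaledPoint (hexadecagonX i) (hexadecagonY i))
          (scaledPoint (hexadecagonX (vnext i)) (hexadecagonY (vnext i))) := by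
      rw [dist_scaledPoint]
      gcongr
      exact Real.le_sqrt_of_sq_le (by exact_mod_cast hexadecagonSide_sq_le i)
    have hsum : ((31365477164866 * 10 ^ 9 : ℤ) : ℝ) < ((∑ i, hexadecagonSide i : ℤ) : ℝ) :=
      Int.cast_lt.mpr lt_sum_hexadecagonSide
    calc (3.1365477164866 : ℝ) = ((31365477164866 * 10 ^ 9 : ℤ) : ℝ) / 10 ^ 22 := by norm_num
      _ < ((∑ i, hexadecagonSide i : ℤ) : ℝ) / 10 ^ 22 := by gcongr
      _ = ∑ i, (hexadecagonSide i : ℝ) / 10 ^ 22 := by rw [Int.cast_sum, Finset.sum_div]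
      _ ≤ _ := Finset.sum_le_sum fun i _ => hside i
end

section
/- Every convex polygon in the Euclidean plane with 32 vertices and diameter at most 1 has perimeter strictly less than 64·sin(π/64). -/
open Real

section

open Finset MeasureTheory Polynomial

lemma vnext_eq_add_one {n : ℕ} [NeZero n] (i : Fin n) : vnext i = i + 1 := by
  ext
  simp [vnext, Fin.val_add]

lemma sum_comp_vnext {n : ℕ} [NeZero n] (x : Fin n → ℝ) : ∑ i, x (vnext i) = ∑ i, x i := by
  simp only [vnext_eq_add_one]
  exact Equiv.sum_comp (Equiv.addRight (1 : Fin n)) x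

/-- Pairwise disjoint half-open subintervals of an interval have total length at most its length. -/
lemma sum_sub_le_of_pairwiseDisjoint_Ico {ι : Type*} (s : Finset ι) (a b : ι → ℝ) {m M : ℝ}
    (hmM : m ≤ M) (hab : ∀ i ∈ s, a i ≤ b i) (hm : ∀ i ∈ s, m ≤ a i) (hM : ∀ i ∈ s, b i ≤ M)
    (hd : (s : Set ι).PairwiseDisjoint fun i => Set.Ico (a i) (b i)) :
    ∑ i ∈ s, (b i - a i) ≤ M - m := by
  have h₁ : volume (⋃ i ∈ s, Set.Ico (a i) (b i)) = ∑ i ∈ s, ENNReal.ofReal (b i - a i) := by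
    rw [measure_biUnion_finset hd fun _ _ => measurableSet_Ico]
    simp
  have h₂ : volume (⋃ i ∈ s, Set.Ico (a i) (b i)) ≤ ENNReal.ofReal (M - m) := by
    rw [← Real.volume_Ico]
    exact measure_mono (Set.iUnion₂_subset fun i hi => Set.Ico_subset_Ico (hm i hi) (hM i hi))
  rw [h₁, ← ENNReal.ofReal_sum_of_nonneg fun i hi => sub_nonneg.2 (hab i hi)] at h₂
  exact (ENNReal.ofReal_le_ofReal_iff (sub_nonneg.2 hmM)).1 h₂

/-- Edges of a convex polygon along which a linear functional increases project to disjoint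
intervals. -/
lemma IsConvexPolygon.disjoint_Ico {n : ℕ} {p : Fin n → EuclideanSpace ℝ (Fin 2)}
    (hconv : IsConvexPolygon p) (a b : ℝ) {x : Fin n → ℝ} (hx : ∀ i, x i = a * p i 0 + b * p i 1)
    {i j : Fin n} (hij : i ≠ j) :
    Disjoint (Set.Ico (x i) (x (vnext i))) (Set.Ico (x j) (x (vnext j))) := by
  rw [Set.disjoint_left]
  rintro t ⟨hi, hi'⟩ ⟨hj, hj'⟩
  let c (i j : Fin n) : ℝ := (p (vnext i) 0 - p i 0) * (p j 1 - p i 1) -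
    (p (vnext i) 1 - p i 1) * (p j 0 - p i 0)
  have hc (i j : Fin n) : 0 ≤ c i j := by
    by_cases h : j = i
    · simp [c, h]
    by_cases h' : j = vnext i
    · simp only [c, h']
      exact (by ring : (0 : ℝ) = _).le
    exact (hconv i j h h').le
  have hne : j ≠ vnext i := by
    rintro rfl
    exact absurd hj (not_le.2 hi')
  have key : (x (vnext j) - t) * c i j + (t - x j) * c i (vnext j) +
      (x (vnext i) - t) * c j i + (t - x i) * c j (vnext i) = 0 := by
    simp only [hx, c]
    ring
  have h₁ := mul_pos (sub_pos.2 hj') (hconv i j hij.symm hne)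
  have h₂ := mul_nonneg (sub_nonneg.2 hj) (hc i (vnext j))
  have h₃ := mul_nonneg (sub_nonneg.2 hi'.le) (hc j i)
  have h₄ := mul_nonneg (sub_nonneg.2 hi) (hc j (vnext i))
  simp only [c] at *
  linarith

/-- The total variation of a linear functional along a convex polygon of diameter at most `1` is at
most twice the norm of the functional. -/
lemma IsConvexPolygon.sum_abs_le {n : ℕ} [NeZero n] {p : Fin n → EuclideanSpace ℝ (Fin 2)}
    (hconv : IsConvexPolygon p) (hdiam : ∀ i j, dist (p i) (p j) ≤ 1) (a b : ℝ) :
    ∑ i, |a * (p (vnext i) 0 - p i 0) + b * (p (vnext i) 1 - p i 1)| ≤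
      2 * √(a ^ 2 + b ^ 2) := by
  set x : Fin n → ℝ := fun i => a * p i 0 + b * p i 1 with hx
  obtain ⟨k, -, hk⟩ := exists_max_image univ x univ_nonempty
  obtain ⟨l, -, hl⟩ := exists_min_image univ x univ_nonempty
  have hwidth : x k - x l ≤ √(a ^ 2 + b ^ 2) := by
    have hd := hdiam k l
    rw [EuclideanSpace.dist_eq, Real.sqrt_le_one, Fin.sum_univ_two, Real.dist_eq, Real.dist_eq,
      sq_abs, sq_abs] at hd
    apply Real.le_sqrt_of_sq_le
    simp only [hx]
    nlinarith [sq_nonneg (a * (p k 1 - p l 1) - b * (p k 0 - p l 0)), sq_nonneg a, sq_nonneg b]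
  have hpos : ∑ i with x i < x (vnext i), (x (vnext i) - x i) ≤ x k - x l :=
    sum_sub_le_of_pairwiseDisjoint_Ico _ _ _ (hl k (mem_univ _))
      (fun i hi => (mem_filter.1 hi).2.le) (fun i _ => hl i (mem_univ _))
      (fun i _ => hk _ (mem_univ _))
      fun i _ j _ hij => hconv.disjoint_Ico a b (fun _ => rfl) hij
  have habs (i : Fin n) : |a * (p (vnext i) 0 - p i 0) + b * (p (vnext i) 1 - p i 1)| =
      2 * (if x i < x (vnext i) then x (vnext i) - x i else 0) - (x (vnext i) - x i) := by
    have : a * (p (vnext i) 0 - p i 0) + b * (p (vnext i) 1 - p i 1) = x (vnext i) - x i := by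
      simp only [hx]; ring
    rw [this]
    split_ifs with h
    · rw [abs_of_pos (sub_pos.2 h)]; ring
    · rw [abs_of_nonpos (by linarith)]; ring
  simp only [habs]
  rw [sum_sub_distrib, ← mul_sum, ← sum_filter, sum_sub_distrib (f := fun i => x (vnext i)) (s := univ),
    sum_comp_vnext, sub_self, sub_zero]
  linarith

/-- The edge vectors of a polygon, as complex numbers. -/
def edgeVector {n : ℕ} (p : Fin n → EuclideanSpace ℝ (Fin 2)) (i : Fin n) : ℂ :=
  ⟨p (vnext i) 0 - p i 0, p (vnext i) 1 - p i 1⟩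

lemma norm_edgeVector {n : ℕ} (p : Fin n → EuclideanSpace ℝ (Fin 2)) (i : Fin n) :
    ‖edgeVector p i‖ = dist (p i) (p (vnext i)) := by
  rw [dist_comm, EuclideanSpace.dist_eq, Fin.sum_univ_two, Real.dist_eq, Real.dist_eq, sq_abs,
    sq_abs, Complex.norm_eq_sqrt_sq_add_sq]
  rfl

lemma sum_edgeVector {n : ℕ} [NeZero n] (p : Fin n → EuclideanSpace ℝ (Fin 2)) :
    ∑ i, edgeVector p i = 0 := by
  apply Complex.ext
  · simp [edgeVector, sum_sub_distrib, sum_comp_vnext fun i => p i 0]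
  · simp [edgeVector, sum_sub_distrib, sum_comp_vnext fun i => p i 1]

lemma IsConvexPolygon.norm_sum_smul_edgeVector_le {n : ℕ} [NeZero n]
    {p : Fin n → EuclideanSpace ℝ (Fin 2)} (hconv : IsConvexPolygon p)
    (hdiam : ∀ i j, dist (p i) (p j) ≤ 1) (δ : Fin n → ℝ) (hδ : ∀ i, |δ i| = 1) :
    ‖∑ i, (δ i : ℂ) * edgeVector p i‖ ≤ 2 := by
  set z := ∑ i, (δ i : ℂ) * edgeVector p i with hz
  have hre : z.re = ∑ i, δ i * (p (vnext i) 0 - p i 0) := by simp [hz, edgeVector]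
  have him : z.im = ∑ i, δ i * (p (vnext i) 1 - p i 1) := by simp [hz, edgeVector]
  have hsq : ‖z‖ ^ 2 ≤ 2 * ‖z‖ := by
    have h := hconv.sum_abs_le hdiam z.re z.im
    rw [← Complex.norm_eq_sqrt_sq_add_sq] at h
    refine le_trans ?_ h
    calc ‖z‖ ^ 2 = z.re * z.re + z.im * z.im := by rw [Complex.sq_norm, Complex.normSq_apply]
      _ = z.re * ∑ i, δ i * (p (vnext i) 0 - p i 0) +
          z.im * ∑ i, δ i * (p (vnext i) 1 - p i 1) := by rw [← hre, ← him]
      _ = ∑ i, δ i * (z.re * (p (vnext i) 0 - p i 0) + z.im * (p (vnext i) 1 - p i 1)) := by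
        rw [mul_sum, mul_sum, ← sum_add_distrib]
        exact sum_congr rfl fun i _ => by ring
      _ ≤ _ := sum_le_sum fun i _ => (le_abs_self _).trans (by rw [abs_mul, hδ, one_mul])
  nlinarith [norm_nonneg z]

/-- An integer combination of the powers `ζ ^ k`, `k < 2 ^ m`, of a primitive `2 ^ (m + 1)`-th root
of unity does not vanish if its constant coefficient does not. -/
lemma sum_intCast_mul_pow_ne_zero {m : ℕ} {ζ : ℂ} (hζ : IsPrimitiveRoot ζ (2 ^ (m + 1)))
    (c : ℕ → ℤ) (hc : c 0 ≠ 0) : ∑ k ∈ range (2 ^ m), (c k : ℂ) * ζ ^ k ≠ 0 := by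
  intro h
  set P : ℚ[X] := ∑ k ∈ range (2 ^ m), C (c k : ℚ) * X ^ k with hP
  have hcoeff : P.coeff 0 = c 0 := by
    simp [hP, coeff_X_pow]
  have hP0 : P ≠ 0 := by
    intro h0
    rw [h0, coeff_zero] at hcoeff
    exact hc (by exact_mod_cast hcoeff.symm)
  have hroot : aeval ζ P = 0 := by simpa [hP] using h
  have hdeg := minpoly.degree_le_of_ne_zero ℚ ζ hP0 hroot
  rw [← cyclotomic_eq_minpoly_rat hζ (by positivity), degree_cyclotomic,
    Nat.totient_prime_pow_succ Nat.prime_two] at hdeg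
  have hlt : P.degree < ((2 ^ m : ℕ) : WithBot ℕ) := by
    rw [degree_lt_iff_coeff_zero]
    intro k hk
    simp [hP, coeff_X_pow, not_lt.2 hk]
  exact absurd (hdeg.trans_lt hlt) (by simp)

lemma norm_exp_mul_I_sub_exp_mul_I (a b : ℝ) :
    ‖Complex.exp (a * Complex.I) - Complex.exp (b * Complex.I)‖ = 2 * |Real.sin ((b - a) / 2)| := by
  have h : Complex.exp (a * Complex.I) - Complex.exp (b * Complex.I) =
      -(Complex.exp (a * Complex.I) * (Complex.exp (Complex.I * ((b - a : ℝ) : ℂ)) - 1)) := by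
    rw [mul_sub, ← Complex.exp_add]
    push_cast
    ring_nf
  rw [h, norm_neg, norm_mul, Complex.norm_exp_ofReal_mul_I, one_mul,
    Complex.norm_exp_I_mul_ofReal_sub_one, norm_mul, Real.norm_eq_abs, Real.norm_eq_abs, abs_two]

lemma sum_sin_le {n : ℕ} {x : ℕ → ℝ} {c : ℝ} (hx : ∀ k ∈ range n, x k ∈ Set.Icc 0 π)
    (hc : ∑ k ∈ range n, x k = n * c) : ∑ k ∈ range n, Real.sin (x k) ≤ n * Real.sin c := by
  rcases n.eq_zero_or_pos with rfl | hn
  · simp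
  have hn' : (0 : ℝ) < n := by exact_mod_cast hn
  have h := strictConcaveOn_sin_Icc.concaveOn.le_map_sum (t := range n) (w := fun _ => (n : ℝ)⁻¹)
    (p := x) (fun _ _ => by positivity) (by simp [hn'.ne']) hx
  simp only [smul_eq_mul, ← mul_sum, hc] at h
  rwa [inv_mul_cancel_left₀ hn'.ne', inv_mul_le_iff₀ hn'] at h

lemma eq_of_sum_sin_eq {n : ℕ} {x : ℕ → ℝ} {c : ℝ} (hx : ∀ k ∈ range n, x k ∈ Set.Icc 0 π)
    (hc : ∑ k ∈ range n, x k = n * c) (h : n * Real.sin c ≤ ∑ k ∈ range n, Real.sin (x k)) :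
    ∀ k ∈ range n, x k = c := by
  rcases n.eq_zero_or_pos with rfl | hn
  · simp
  have hn' : (0 : ℝ) < n := by exact_mod_cast hn
  have hmean : ∑ k ∈ range n, (n : ℝ)⁻¹ • x k = c := by
    simp only [smul_eq_mul, ← mul_sum, hc]
    rw [inv_mul_cancel_left₀ hn'.ne']
  have heq := (strictConcaveOn_sin_Icc.map_sum_eq_iff (t := range n) (w := fun _ => (n : ℝ)⁻¹)
    (p := x) (fun _ _ => by positivity) (by simp [hn'.ne']) hx).1 (by
      rw [hmean]
      simp only [smul_eq_mul, ← mul_sum]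
      rw [le_antisymm (sum_sin_le hx hc) h, inv_mul_cancel_left₀ hn'.ne'])
  intro k hk
  rw [heq k hk, hmean]

/-- The sign of the `j`-th summand in the `k`-th vertex of a centrally symmetric polygon. -/
def halfSign (k j : ℕ) : ℝ := if j < k then 1 else -1

lemma abs_halfSign (k j : ℕ) : |halfSign k j| = 1 := by
  unfold halfSign; split_ifs <;> simp

lemma sum_halfSign_smul {n j : ℕ} (hj : j < n) {U : ℕ → ℂ} (hU : U n = -U 0) :
    ∑ k ∈ range n, halfSign k j • (U k - U (k + 1)) = (2 : ℝ) • U (j + 1) := by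
  have h := sum_range_sub' (fun k => if k ≤ j then -U k else U k - (2 : ℝ) • U (j + 1)) n
  simp only [not_le.2 hj, Nat.zero_le, if_true, if_false, hU] at h
  rw [show (2 : ℝ) • U (j + 1) = -U 0 - (-U 0 - (2 : ℝ) • U (j + 1)) by abel, ← h]
  refine sum_congr rfl fun k _ => ?_
  rcases lt_trichotomy k j with hk | rfl | hk
  · simp [halfSign, hk.le, Nat.succ_le_of_lt hk, not_lt.2 hk.le]; ring
  · simp [halfSign, two_smul]; ring
  · simp [halfSign, hk, not_le.2 hk, not_le.2 (hk.trans (Nat.lt_succ_self k))]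

/-- Summation by parts: the perimeter of a centrally symmetric polygon through its vertices and
its unit edge directions. -/
lemma sum_inner_halfSign {n : ℕ} {U : ℕ → ℂ} (hU : U n = -U 0) (f : ℕ → ℂ) :
    ∑ k ∈ range n, inner ℝ (∑ j ∈ range n, halfSign k j • f j) (U k - U (k + 1)) =
      2 * ∑ j ∈ range n, inner ℝ (f j) (U (j + 1)) := by
  simp only [sum_inner, real_inner_smul_left]
  rw [sum_comm, mul_sum]
  refine sum_congr rfl fun j hj => ?_
  rw [← real_inner_smul_right, ← sum_halfSign_smul (mem_range.1 hj) hU, inner_sum]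
  exact sum_congr rfl fun k _ => (real_inner_smul_right ..).symm

lemma smul_eq_of_norm_mul_le_inner {q v : ℂ} {r : ℝ} (hq : ‖q‖ ≤ r) (h : r * ‖v‖ ≤ inner ℝ q v) :
    ‖v‖ • q = r • v := by
  have hr : 0 ≤ r := (norm_nonneg q).trans hq
  rw [← sub_eq_zero, ← norm_eq_zero, ← sq_eq_zero_iff]
  refine le_antisymm ?_ (sq_nonneg _)
  rw [norm_sub_sq_real, real_inner_smul_left, real_inner_smul_right, norm_smul, norm_smul,
    norm_norm, Real.norm_of_nonneg hr]
  have h₁ : ‖v‖ * ‖q‖ ≤ ‖v‖ * r := mul_le_mul_of_nonneg_left hq (norm_nonneg v)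
  have h₂ : (‖v‖ * ‖q‖) ^ 2 ≤ (‖v‖ * r) ^ 2 := by gcongr
  have h₃ : ‖v‖ * r * (r * ‖v‖) ≤ ‖v‖ * r * inner ℝ q v :=
    mul_le_mul_of_nonneg_left h (by positivity)
  nlinarith

/-- Reinhardt's inequality for sorted edge directions `Φ 1 ≤ … ≤ Φ n = Φ 0 + π`, strict when the
number of edges is a power of two. -/
lemma sum_lt_of_norm_sum_smul_le {m n : ℕ} (hn : n = 2 ^ m) {Φ l : ℕ → ℝ} {f : ℕ → ℂ}
    {ε : ℕ → ℤ} (hΦ : ∀ k < n, Φ k ≤ Φ (k + 1)) (hΦn : Φ n = Φ 0 + π)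
    (hf : ∀ j < n, f j = l j • Complex.exp (Φ (j + 1) * Complex.I))
    (hbound : ∀ δ : ℕ → ℝ, (∀ j, |δ j| = 1) → ‖∑ j ∈ range n, δ j • f j‖ ≤ 2)
    (hε : ε 0 ≠ 0) (hsum : ∑ j ∈ range n, (ε j : ℂ) * f j = 0) :
    ∑ j ∈ range n, l j < 2 * n * Real.sin (π / (2 * n)) := by
  have hn0 : (0 : ℝ) < n := by rw [hn]; positivity
  set c : ℝ := π / (2 * n) with hc
  set U : ℕ → ℂ := fun k => Complex.exp (Φ k * Complex.I) with hU
  have hUn : U n = -U 0 := by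
    simp only [hU, hΦn]
    push_cast
    rw [add_mul, Complex.exp_add, Complex.exp_pi_mul_I]
    ring
  set q : ℕ → ℂ := fun k => ∑ j ∈ range n, halfSign k j • f j with hq
  have hq2 (k : ℕ) : ‖q k‖ ≤ 2 := hbound _ (abs_halfSign k)
  set x : ℕ → ℝ := fun k => (Φ (k + 1) - Φ k) / 2 with hx
  have hxsum : ∑ k ∈ range n, x k = n * c := by
    rw [← sum_div, sum_range_sub, hΦn, hc]
    field_simp
    ring
  have hx0 : ∀ k ∈ range n, 0 ≤ x k := fun k hk =>
    div_nonneg (sub_nonneg.2 (hΦ k (mem_range.1 hk))) zero_le_two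
  have hxmem : ∀ k ∈ range n, x k ∈ Set.Icc 0 π := fun k hk => ⟨hx0 k hk, by
    have := single_le_sum hx0 hk
    rw [hxsum, hc] at this
    have h' : n * (π / (2 * n)) = π / 2 := by field_simp
    linarith [pi_pos]⟩
  have hv : ∀ k ∈ range n, ‖U k - U (k + 1)‖ = 2 * Real.sin (x k) := fun k hk => by
    rw [norm_exp_mul_I_sub_exp_mul_I,
      abs_of_nonneg (Real.sin_nonneg_of_mem_Icc (hxmem k hk))]
  have hinner : ∑ k ∈ range n, inner ℝ (q k) (U k - U (k + 1)) = 2 * ∑ j ∈ range n, l j := by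
    rw [sum_inner_halfSign hUn]
    congr 1
    refine sum_congr rfl fun j hj => ?_
    rw [hf j (mem_range.1 hj), real_inner_smul_left, real_inner_self_eq_norm_sq,
      Complex.norm_exp_ofReal_mul_I]
    ring
  have hle : ∀ k ∈ range n, inner ℝ (q k) (U k - U (k + 1)) ≤ 2 * ‖U k - U (k + 1)‖ := fun k _ =>
    (real_inner_le_norm _ _).trans (mul_le_mul_of_nonneg_right (hq2 k) (norm_nonneg _))
  have hvsum : ∑ k ∈ range n, 2 * ‖U k - U (k + 1)‖ = 4 * ∑ k ∈ range n, Real.sin (x k) := by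
    rw [mul_sum]
    exact sum_congr rfl fun k hk => by rw [hv k hk]; ring
  have hjensen := sum_sin_le hxmem hxsum
  have htotal := sum_le_sum hle
  by_contra! hcon
  have hxc := eq_of_sum_sin_eq hxmem hxsum (by linarith)
  have heq := (sum_eq_sum_iff_of_le hle).1 (by linarith)
  set ζ : ℂ := Complex.exp (2 * c * Complex.I) with hζ
  have hUk : ∀ k ≤ n, U k = U 0 * ζ ^ k := by
    intro k
    induction k with
    | zero => simp
    | succ k ih =>
      intro hk
      have hstep : Φ (k + 1) = Φ k + 2 * c := by
        have := hxc k (mem_range.2 hk)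
        simp only [hx] at this
        linarith
      rw [pow_succ, ← mul_assoc, ← ih (Nat.le_of_succ_le hk), hζ]
      simp only [hU, hstep]
      rw [← Complex.exp_add]
      push_cast
      ring_nf
  have hU0 : U 0 ≠ 0 := Complex.exp_ne_zero _
  have hζn : ζ ^ n = -1 := by
    have := hUk n le_rfl
    rw [hUn] at this
    exact mul_left_cancel₀ hU0 (by rw [← this]; ring)
  have hζprim : IsPrimitiveRoot ζ (2 ^ (m + 1)) := by
    have h := Complex.isPrimitiveRoot_exp (2 ^ (m + 1)) (by positivity)
    convert h using 1
    rw [hζ, hc, hn]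
    congr 1
    push_cast
    field_simp
    ring
  have hvert : ∀ k ≤ n, (2 * Real.sin c) • q k = (2 : ℝ) • (U 0 * ζ ^ k * (1 - ζ)) := by
    have haux : ∀ k < n, (2 * Real.sin c) • q k = (2 : ℝ) • (U 0 * ζ ^ k * (1 - ζ)) := by
      intro k hk
      have hk' := mem_range.2 hk
      have h := smul_eq_of_norm_mul_le_inner (hq2 k) (heq k hk').ge
      rw [hv k hk', hxc k hk'] at h
      rw [h, hUk k hk.le, hUk (k + 1) hk]
      congr 1
      ring
    intro k hk
    rcases hk.lt_or_eq with hk | rfl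
    · exact haux k hk
    · have hqn : q k = -q 0 := by
        simp only [hq, ← sum_neg_distrib]
        refine sum_congr rfl fun j hj => ?_
        simp [halfSign, mem_range.1 hj]
      rw [hqn, smul_neg, haux 0 (by exact_mod_cast hn0), hζn, ← smul_neg]
      congr 1
      ring
  have hqf : ∀ k < n, q (k + 1) - q k = (2 : ℝ) • f k := by
    intro k hk
    simp only [hq, ← sum_sub_distrib, ← sub_smul]
    rw [sum_eq_single_of_mem k (mem_range.2 hk)]
    · norm_num [halfSign]
    · intro j _ hj
      rcases lt_or_gt_of_ne hj with hj | hj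
      · simp [halfSign, hj, hj.trans (Nat.lt_succ_self k)]
      · simp [halfSign, not_lt.2 hj.le, not_lt.2 (Nat.succ_le_of_lt hj)]
  have hfk : ∀ k < n, ((2 * Real.sin c : ℝ) : ℂ) * f k = -(U 0 * (1 - ζ) ^ 2) * ζ ^ k := by
    intro k hk
    have h₁ := hvert (k + 1) hk
    have h₂ := hvert k hk.le
    have h₃ := hqf k hk
    simp only [Complex.real_smul, Complex.ofReal_ofNat] at h₁ h₂ h₃
    refine mul_left_cancel₀ (two_ne_zero (α := ℂ)) ?_
    rw [mul_left_comm, ← h₃, mul_sub, h₁, h₂]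
    ring
  have hζ1 : 1 - ζ ≠ 0 := by
    intro h
    rw [← sub_eq_zero.1 h, one_pow] at hζn
    norm_num at hζn
  have hzero : -(U 0 * (1 - ζ) ^ 2) * ∑ k ∈ range n, (ε k : ℂ) * ζ ^ k = 0 := by
    rw [← mul_zero ((2 * Real.sin c : ℝ) : ℂ), ← hsum, mul_sum, mul_sum]
    refine sum_congr rfl fun k hk => ?_
    rw [mul_left_comm, ← hfk k (mem_range.1 hk), mul_left_comm]
  rcases mul_eq_zero.1 hzero with h | h
  · exact neg_ne_zero.2 (mul_ne_zero hU0 (pow_ne_zero 2 hζ1)) h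
  · subst hn
    exact sum_intCast_mul_pow_ne_zero hζprim ε hε h

lemma exists_angle_mem_Icc (z : ℂ) : ∃ φ ∈ Set.Icc 0 π, ∃ s : ℤ, |s| = 1 ∧
    z = s * (‖z‖ * Complex.exp (φ * Complex.I)) := by
  rcases le_or_gt 0 z.arg with h | h
  · exact ⟨z.arg, ⟨h, z.arg_le_pi⟩, 1, by simp, by simp [Complex.norm_mul_exp_arg_mul_I]⟩
  · refine ⟨z.arg + π, ⟨by linarith [z.neg_pi_lt_arg], by linarith⟩, -1, by simp, ?_⟩
    push_cast
    rw [add_mul, Complex.exp_add, Complex.exp_pi_mul_I]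
    linear_combination -Complex.norm_mul_exp_arg_mul_I z

lemma sum_range_comp_ofNat {M : Type*} [AddCommMonoid M] {n : ℕ} [NeZero n]
    (σ : Equiv.Perm (Fin n)) (F : Fin n → M) :
    ∑ k ∈ range n, F (σ (Fin.ofNat n k)) = ∑ i, F i := by
  rw [sum_range, ← Equiv.sum_comp σ F]
  simp

/-- Reinhardt's inequality is strict for convex polygons whose number of sides is a power of two. -/
theorem IsConvexPolygon.perimeter_lt {m n : ℕ} (hn : n = 2 ^ m)
    {p : Fin n → EuclideanSpace ℝ (Fin 2)} (hconv : IsConvexPolygon p)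
    (hdiam : ∀ i j, dist (p i) (p j) ≤ 1) :
    perimeter p < 2 * n * Real.sin (π / (2 * n)) := by
  have hn0 : 0 < n := by rw [hn]; positivity
  have : NeZero n := ⟨hn0.ne'⟩
  choose φ hφ s hs hz using fun i => exists_angle_mem_Icc (edgeVector p i)
  set σ := Tuple.sort φ
  have hσ : Monotone (φ ∘ σ) := Tuple.monotone_sort φ
  set g : ℕ → Fin n := fun k => σ (Fin.ofNat n k) with hg
  have hss (i : Fin n) : (s i : ℂ) * s i = 1 := by
    have := abs_mul_abs_self (s i)
    rw [hs, one_mul] at this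
    exact_mod_cast this.symm
  have hper : perimeter p = ∑ j ∈ range n, ‖edgeVector p (g j)‖ := by
    rw [sum_range_comp_ofNat σ fun i => ‖edgeVector p i‖]
    exact sum_congr rfl fun i _ => (norm_edgeVector p i).symm
  rw [hper]
  refine sum_lt_of_norm_sum_smul_le hn (ε := fun j => s (g j))
    (Φ := fun k => if k = 0 then φ (g (n - 1)) - π else φ (g (k - 1)))
    (f := fun j => s (g j) * edgeVector p (g j)) ?_ ?_ ?_ ?_ ?_ ?_
  · intro k hk
    rcases k.eq_zero_or_pos with rfl | hk0
    · simpa using (sub_nonpos.2 (hφ (g (n - 1))).2).trans (hφ (g 0)).1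
    · simp only [hk0.ne', if_false, Nat.add_one_ne_zero, Nat.add_sub_cancel]
      apply hσ
      rw [Fin.le_def, Fin.val_ofNat, Fin.val_ofNat, Nat.mod_eq_of_lt hk,
        Nat.mod_eq_of_lt (by omega)]
      omega
  · simp [hn0.ne']
  · intro j _
    simp only [Nat.add_one_ne_zero, if_false, Nat.add_sub_cancel, Complex.real_smul]
    nth_rewrite 1 [hz (g j)]
    rw [← mul_assoc, hss, one_mul]
  · intro δ hδ
    have h := hconv.norm_sum_smul_edgeVector_le hdiam
      (fun i => δ (σ.symm i) * s i) fun i => by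
        rw [abs_mul, hδ, one_mul, ← Int.cast_abs, hs, Int.cast_one]
    rw [← sum_range_comp_ofNat σ] at h
    convert h using 2
    refine sum_congr rfl fun j hj => ?_
    simp [hg, Nat.mod_eq_of_lt (mem_range.1 hj), mul_assoc]
  · intro h
    have := hs (g 0)
    simp [h] at this
  · simp only [← mul_assoc, hss, one_mul]
    rw [sum_range_comp_ofNat σ, sum_edgeVector]

end

/-- Every convex `32`-gon of diameter at most `1` has perimeter strictly less
than `64 sin (π / 64)`. -/
theorem perimeter_lt_of_small_32gon
    (p : Fin 32 → EuclideanSpace ℝ (Fin 2)) (hconv : IsConvexPolygon p)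
    (hdiam : ∀ i j : Fin 32, dist (p i) (p j) ≤ 1) :
    perimeter p < 64 * Real.sin (π / 64) := by
  have h := hconv.perimeter_lt (m := 5) (by norm_num) hdiam
  norm_num at h
  exact h
end
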